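/- arXiv:math/9812144 — 8 statements merged into one kernel-verified Lean document; each statement's English description precedes it below -/
import Mathlib

section
/- Suppose ξ_j ≤ ξ̄ < 1 for all j ∈ J, |δ_i| ≤ Δ for all i ≥ 1 with Δ > 0, and suppose that at stage n ≥ 1 the unperturbed diameter satisfies Π_n > ξ̄Δ/(1 − ξ̄). Then N_n > −Π_n; that is, the generating set at stage n cannot collapse. -/
open Finset

/-- A perturbed contraction recursion with ratios at most `r < 1` and noise at least `-D`
stays above `-r * D / (1 - r)`. -/
theorem neg_mul_div_one_sub_le_of_recursion {c δ N : ℕ → ℝ} {r D : ℝ}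
    (hN0 : N 0 = 0) (hN : ∀ n, N (n + 1) = c (n + 1) * (N n + δ (n + 1)))
    (hc : ∀ n, 0 ≤ c n) (hcr : ∀ n, c n ≤ r) (hr : r < 1) (hD : 0 ≤ D)
    (hδ : ∀ n, -D ≤ δ (n + 1)) (n : ℕ) : -(r * D / (1 - r)) ≤ N n := by
  have hr0 : 0 ≤ r := (hc 0).trans (hcr 0)
  have hr1 : 0 < 1 - r := sub_pos.2 hr
  have hB : 0 ≤ r * D / (1 - r) := by positivity
  have hfix : r * (r * D / (1 - r) + D) = r * D / (1 - r) := by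
    field_simp
    ring
  induction n with
  | zero => simpa [hN0] using hB
  | succ k ih =>
    rw [hN]
    calc -(r * D / (1 - r)) = -(r * (r * D / (1 - r) + D)) := by rw [hfix]
      _ ≤ -(c (k + 1) * (r * D / (1 - r) + D)) :=
        neg_le_neg (mul_le_mul_of_nonneg_right (hcr _) (add_nonneg hB hD))
      _ = c (k + 1) * -(r * D / (1 - r) + D) := by ring
      _ ≤ c (k + 1) * (N k + δ (k + 1)) :=
        mul_le_mul_of_nonneg_left (by linarith [hδ k]) (hc _)

/-- if the unperturbed diameter at stage `n` exceeds `ξ̄Δ/(1-ξ̄)`,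
the generating set at stage `n` cannot collapse. -/
theorem stmt_2 {J : Type*} [Fintype J] [Nonempty J]
    (ξ : J → ℝ) (hξ : ∀ a, 0 < ξ a ∧ ξ a < 1)
    (j : ℕ → J) (δ : ℕ → ℝ) (N P : ℕ → ℝ)
    (hN0 : N 0 = 0) (hN : ∀ n, N (n + 1) = ξ (j (n + 1)) * (N n + δ (n + 1)))
    (hP : ∀ n, P n = ∏ i ∈ Finset.Icc 1 n, ξ (j i))
    (ξbar Δ : ℝ) (hξbar : ∀ a, ξ a ≤ ξbar) (hξbar1 : ξbar < 1)
    (hΔ : 0 < Δ) (hδ : ∀ i, 1 ≤ i → |δ i| ≤ Δ)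
    (n : ℕ) (hn : 1 ≤ n)
    (hbig : P n > ξbar * Δ / (1 - ξbar)) :
    N n > -P n := by
  have h := neg_mul_div_one_sub_le_of_recursion (c := fun i => ξ (j i)) hN0 hN
    (fun i => (hξ (j i)).1.le) (fun i => hξbar (j i)) hξbar1 hΔ.le
    (fun i => (abs_le.1 (hδ (i + 1) (Nat.le_add_left 1 i))).1) n
  linarith
end

section
/- Assign to each index j ∈ J a noise amplitude Δ_j with 0 < Δ' ≤ Δ_j ≤ Δ, and suppose ξ_j ≤ ξ̄ for all j, where ξ̄ ≤ Δ'/(2Δ + Δ'). Suppose |δ_i| ≤ Δ for all i ≤ n−1, that Π_{n−1} ≤ ξ̄Δ/(1 − ξ̄), and that δ_n = −Δ_{j_n}. Then N_n ≤ −Π_n; that is, if the last noise step is negative then the generating set at stage n must collapse. -/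
open Finset

/-- A sequence with `N (k + 1) ≤ r k * (N k + δ (k + 1))`, ratios in `[0, ρ]` and steps at most `Δ`
stays below the fixed point `ρ * Δ / (1 - ρ)` of `x ↦ ρ * (x + Δ)`. -/
lemma le_fixed_point_of_contracting_steps {r δ N : ℕ → ℝ} {ρ Δ : ℝ} {m : ℕ}
    (hΔ : 0 ≤ Δ) (hρ0 : 0 ≤ ρ) (hρ : ρ < 1) (hr0 : ∀ k, 0 ≤ r k) (hr : ∀ k, r k ≤ ρ)
    (hN0 : N 0 ≤ 0) (hN : ∀ k, N (k + 1) ≤ r k * (N k + δ (k + 1)))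
    (hδ : ∀ i, 1 ≤ i → i ≤ m → δ i ≤ Δ) :
    N m ≤ ρ * Δ / (1 - ρ) := by
  have hpos : 0 < 1 - ρ := by linarith
  have hB : 0 ≤ ρ * Δ / (1 - ρ) := by positivity
  have key : ∀ k, k ≤ m → N k ≤ ρ * Δ / (1 - ρ) := by
    intro k
    induction k with
    | zero => exact fun _ => hN0.trans hB
    | succ k ih =>
      intro hk
      have hstep : N k + δ (k + 1) ≤ ρ * Δ / (1 - ρ) + Δ :=
        add_le_add (ih (by lia)) (hδ _ (by lia) hk)
      calc N (k + 1) ≤ r k * (N k + δ (k + 1)) := hN k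
        _ ≤ r k * (ρ * Δ / (1 - ρ) + Δ) := mul_le_mul_of_nonneg_left hstep (hr0 k)
        _ ≤ ρ * (ρ * Δ / (1 - ρ) + Δ) := mul_le_mul_of_nonneg_right (hr k) (by positivity)
        _ = ρ * Δ / (1 - ρ) := by
          field_simp
          ring
  exact key m le_rfl

/-- once `Π_{n-1} ≤ ξ̄Δ/(1-ξ̄)` and `ξ̄ ≤ Δ'/(2Δ+Δ')`, a negative
last noise step `δ_n = -Δ_{j_n}` forces collapse at stage `n`. -/
theorem stmt_3 {J : Type*} [Fintype J] [Nonempty J]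
    (ξ : J → ℝ) (hξ : ∀ a, 0 < ξ a ∧ ξ a < 1)
    (j : ℕ → J) (δ : ℕ → ℝ) (N P : ℕ → ℝ)
    (hN0 : N 0 = 0) (hN : ∀ n, N (n + 1) = ξ (j (n + 1)) * (N n + δ (n + 1)))
    (hP : ∀ n, P n = ∏ i ∈ Finset.Icc 1 n, ξ (j i))
    (ξbar Δ Δ' : ℝ) (Δf : J → ℝ)
    (hΔ' : 0 < Δ') (hΔf : ∀ a, Δ' ≤ Δf a ∧ Δf a ≤ Δ)
    (hξbar : ∀ a, ξ a ≤ ξbar)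
    (hbar : ξbar ≤ Δ' / (2 * Δ + Δ'))
    (n : ℕ) (hn : 1 ≤ n)
    (hδ : ∀ i, 1 ≤ i → i ≤ n - 1 → |δ i| ≤ Δ)
    (hPn : P (n - 1) ≤ ξbar * Δ / (1 - ξbar))
    (hlast : δ n = -Δf (j n)) :
    N n ≤ -P n := by
  obtain ⟨m, rfl⟩ : ∃ m, n = m + 1 := ⟨n - 1, by lia⟩
  rw [Nat.add_sub_cancel] at hδ hPn
  have hξpos := (hξ (j (m + 1))).1
  have hΔf_last := (hΔf (j (m + 1))).1
  have hΔ : 0 < Δ := by linarith [(hΔf (j (m + 1))).2]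
  have hbar_pos : 0 < ξbar := hξpos.trans_le (hξbar _)
  have hbar_mul : ξbar * (2 * Δ + Δ') ≤ Δ' := (le_div_iff₀ (by positivity)).1 hbar
  have hbar_one : ξbar < 1 := by nlinarith
  have hNm : N m ≤ ξbar * Δ / (1 - ξbar) :=
    le_fixed_point_of_contracting_steps (r := fun k => ξ (j (k + 1))) hΔ.le hbar_pos.le hbar_one
      (fun k => (hξ _).1.le) (fun k => hξbar _) hN0.le (fun k => (hN k).le)
      (fun i h1 h2 => (le_abs_self _).trans (hδ i h1 h2))
  have hfix : ξbar * Δ / (1 - ξbar) ≤ Δ' / 2 := by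
    rw [div_le_iff₀ (by linarith)]
    linarith
  have hPsucc : P (m + 1) = ξ (j (m + 1)) * P m := by
    rw [hP, hP, Finset.prod_Icc_succ_top (by lia), mul_comm]
  rw [hN, hPsucc, hlast, ← mul_neg]
  exact mul_le_mul_of_nonneg_left (by linarith) hξpos.le
end

section
/- Suppose ξ_j ≤ ξ̄ < 1 for all j ∈ J, let ε > 0, and suppose δ_i = −ε for all 1 ≤ i ≤ n. If ε · Σ_{i=0}^{n−1} ξ̄^{−i} > 1, then N_n < −Π_n; that is, n consecutive negative noise steps of size ε from the start force collapse by stage n. In particular, with n₀ = ⌊ log(1 + (1/ξ̄ − 1)/ε) / log(1/ξ̄) ⌋ + 1 and ε < 1, collapse occurs by stage n₀. -/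
open Finset Real

/-- A product of `n` positive factors bounded by `c` is at most `c ^ n`, in inverted form. -/
theorem prod_Icc_mul_inv_pow_le_one {x : ℕ → ℝ} {c : ℝ} (hx : ∀ i, 0 < x i) (hxc : ∀ i, x i ≤ c)
    (n : ℕ) : (∏ i ∈ Finset.Icc 1 n, x i) * (1 / c) ^ n ≤ 1 := by
  have hc : 0 < c := (hx 0).trans_le (hxc 0)
  have h : ∏ i ∈ Finset.Icc 1 n, x i ≤ c ^ n := by
    simpa using Finset.prod_le_prod (s := Finset.Icc 1 n) (fun i _ => (hx i).le)
      (fun i _ => hxc i)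
  rw [one_div, inv_pow, ← div_eq_mul_inv]
  exact div_le_one_of_le₀ h (pow_pos hc n).le

/-- Under constant noise `-ε`, the noise term is bounded by a geometric sum times the product of
the contraction ratios. -/
theorem noise_term_le_neg_geom_sum {x δ N : ℕ → ℝ} {c ε : ℝ} (hx : ∀ i, 0 < x i)
    (hxc : ∀ i, x i ≤ c) (hε : 0 ≤ ε) (hN0 : N 0 = 0)
    (hN : ∀ n, N (n + 1) = x (n + 1) * (N n + δ (n + 1))) (n : ℕ)
    (hδ : ∀ i, 1 ≤ i → i ≤ n → δ i = -ε) :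
    N n ≤ -((∏ i ∈ Finset.Icc 1 n, x i) * (ε * ∑ i ∈ Finset.range n, (1 / c) ^ i)) := by
  induction n with
  | zero => simp [hN0]
  | succ n ih =>
    have ih := ih fun i h1 h2 => hδ i h1 (h2.trans n.le_succ)
    have hP := mul_le_mul_of_nonneg_left (prod_Icc_mul_inv_pow_le_one hx hxc n) hε
    rw [hN, hδ (n + 1) n.succ_pos le_rfl, Finset.prod_Icc_succ_top n.succ_pos,
      Finset.sum_range_succ]
    calc x (n + 1) * (N n + -ε)
        ≤ x (n + 1) * (-((∏ i ∈ Finset.Icc 1 n, x i) *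
            (ε * (∑ i ∈ Finset.range n, (1 / c) ^ i + (1 / c) ^ n)))) :=
          mul_le_mul_of_nonneg_left (by linarith) (hx _).le
      _ = _ := by ring

/-- The geometric sum of ratio `r > 1` exceeds `1 / ε` once it has more than
`log (1 + (r - 1) / ε) / log r` terms. -/
theorem one_lt_mul_geom_sum {r ε : ℝ} (hr : 1 < r) (hε : 0 < ε) {n : ℕ}
    (hn : Real.log (1 + (r - 1) / ε) / Real.log r < n) :
    1 < ε * ∑ i ∈ Finset.range n, r ^ i := by
  have hr' : 0 < r - 1 := sub_pos.2 hr
  rw [div_lt_iff₀ (Real.log_pos hr), ← Real.log_pow] at hn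
  have h := (Real.log_lt_log_iff (by positivity) (by positivity)).1 hn
  have h' : (r - 1) / ε < r ^ n - 1 := by linarith
  rw [div_lt_iff₀ hε] at h'
  rw [geom_sum_eq hr.ne', mul_div_assoc', lt_div_iff₀ hr']
  linarith

/-- `n` consecutive negative noise steps of size `ε` from the start
force collapse by stage `n` whenever `ε·Σ_{i<n} ξ̄^{-i} > 1`; in particular,
with `n₀ = ⌊log(1 + (1/ξ̄-1)/ε)/log(1/ξ̄)⌋ + 1` and `ε < 1`, collapse occurs by
stage `n₀`. -/
theorem stmt_7 {J : Type*} [Fintype J] [Nonempty J]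
    (ξ : J → ℝ) (hξ : ∀ a, 0 < ξ a ∧ ξ a < 1)
    (j : ℕ → J) (δ : ℕ → ℝ) (N P : ℕ → ℝ)
    (hN0 : N 0 = 0) (hN : ∀ n, N (n + 1) = ξ (j (n + 1)) * (N n + δ (n + 1)))
    (hP : ∀ n, P n = ∏ i ∈ Finset.Icc 1 n, ξ (j i))
    (ξbar ε : ℝ) (hξbar : ∀ a, ξ a ≤ ξbar) (hξbar1 : ξbar < 1) (hε : 0 < ε) :
    (∀ n, 1 ≤ n → (∀ i, 1 ≤ i → i ≤ n → δ i = -ε) →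
        ε * ∑ i ∈ Finset.range n, (1 / ξbar) ^ i > 1 → N n < -P n) ∧
      (ε < 1 → ∀ n₀ : ℕ,
        n₀ = ⌊Real.log (1 + (1 / ξbar - 1) / ε) / Real.log (1 / ξbar)⌋₊ + 1 →
        (∀ i, 1 ≤ i → i ≤ n₀ → δ i = -ε) → N n₀ < -P n₀) := by
  have hx : ∀ i, 0 < ξ (j i) := fun i => (hξ _).1
  have hcollapse : ∀ n, (∀ i, 1 ≤ i → i ≤ n → δ i = -ε) →
      1 < ε * ∑ i ∈ Finset.range n, (1 / ξbar) ^ i → N n < -P n := by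
    intro n hδ hsum
    have hPn : 0 < ∏ i ∈ Finset.Icc 1 n, ξ (j i) := Finset.prod_pos fun i _ => hx i
    have hNn := noise_term_le_neg_geom_sum hx (fun i => hξbar (j i)) hε.le hN0 hN n hδ
    rw [hP]
    exact hNn.trans_lt (neg_lt_neg (lt_mul_of_one_lt_right hPn hsum))
  refine ⟨fun n _ => hcollapse n, fun _ n₀ hn₀ hδ => hcollapse n₀ hδ ?_⟩
  have hr : 1 < 1 / ξbar := (one_lt_div ((hx 0).trans_le (hξbar _))).2 hξbar1
  refine one_lt_mul_geom_sum hr hε ?_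
  rw [hn₀]
  exact_mod_cast Nat.lt_floor_add_one _
end

section
/- Suppose ξ_j ≤ ξ̄ < 1 for all j ∈ J, let 0 < ε, suppose ξ̄ + ε/(1 − ξ̄) < 1, and suppose δ_i ∈ {−ε, ε} for all i. Then for every k ≥ 1, Π_k + N_k < ξ̄ + ε/(1 − ξ̄) < 1. -/
open Finset

/-- for `±ε` noise with `ξ̄ + ε/(1-ξ̄) < 1`, the quantity
`Π_k + N_k` stays below `ξ̄ + ε/(1-ξ̄) < 1` for all `k ≥ 1`. -/
theorem stmt_9 {J : Type*} [Fintype J] [Nonempty J]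
    (ξ : J → ℝ) (hξ : ∀ a, 0 < ξ a ∧ ξ a < 1)
    (j : ℕ → J) (δ : ℕ → ℝ) (N P : ℕ → ℝ)
    (hN0 : N 0 = 0) (hN : ∀ n, N (n + 1) = ξ (j (n + 1)) * (N n + δ (n + 1)))
    (hP : ∀ n, P n = ∏ i ∈ Finset.Icc 1 n, ξ (j i))
    (ξbar ε : ℝ) (hξbar : ∀ a, ξ a ≤ ξbar) (hξbar1 : ξbar < 1)
    (hε : 0 < ε) (hcond : ξbar + ε / (1 - ξbar) < 1)
    (hδ : ∀ i, 1 ≤ i → δ i = -ε ∨ δ i = ε) :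
    ∀ k, 1 ≤ k → P k + N k < ξbar + ε / (1 - ξbar) ∧ ξbar + ε / (1 - ξbar) < 1 := by
  have hstep : ∀ n, P n + N n ≤ 1 → P (n + 1) + N (n + 1) < ξbar + ε / (1 - ξbar) := by
    intro n hn
    have hrec : P (n + 1) + N (n + 1) = ξ (j (n + 1)) * (P n + N n + δ (n + 1)) := by
      rw [hN, hP, hP, Finset.prod_Icc_succ_top (by omega)]
      ring
    have hδle : δ (n + 1) ≤ ε := by
      rcases hδ (n + 1) (by omega) with h | h <;> linarith
    have hpos := (hξ (j (n + 1))).1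
    have hle := hξbar (j (n + 1))
    have hεle : ε ≤ ε / (1 - ξbar) :=
      le_div_self hε.le (by linarith) (by linarith)
    calc P (n + 1) + N (n + 1) = ξ (j (n + 1)) * (P n + N n + δ (n + 1)) := hrec
      _ ≤ ξ (j (n + 1)) * (1 + ε) := by gcongr
      _ ≤ ξbar * (1 + ε) := by gcongr
      _ < ξbar + ε := by nlinarith
      _ ≤ ξbar + ε / (1 - ξbar) := by gcongr
  have hle_one : ∀ n, P n + N n ≤ 1 := by
    intro n
    induction n with
    | zero => simp [hP, hN0]
    | succ n ih => exact ((hstep n ih).trans hcond).le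
  intro k hk
  obtain ⟨n, rfl⟩ := Nat.exists_eq_add_of_le' hk
  exact ⟨hstep n (hle_one n), hcond⟩
end

section
/- Suppose ξ_j ≤ ξ̄ < 1 for all j ∈ J and ε > 0. Fix k ≥ 0 and l ≥ 1, and suppose δ_{k+1} = δ_{k+2} = ⋯ = δ_{k+l} = −ε. If ε · Σ_{i=0}^{l−1} ξ̄^{−i} > Π_k + N_k, then N_{k+l} < −Π_{k+l}; that is, the generating set collapses at stage k + l. -/
open Finset

/-- A recursion `S (n + 1) = c n * (S n - ε)` with multipliers in `(0, q]` becomes negative after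
`l` steps if it starts below `ε * ∑ i < l, q⁻¹ ^ i`. -/
theorem neg_of_lt_geom_sum {S c : ℕ → ℝ} {q ε : ℝ} (hc : ∀ n, 0 < c n) (hcq : ∀ n, c n ≤ q)
    (hε : 0 ≤ ε) (l k : ℕ) (hS : ∀ n, k ≤ n → n < k + l → S (n + 1) = c n * (S n - ε))
    (h : S k < ε * ∑ i ∈ Finset.range l, (1 / q) ^ i) : S (k + l) < 0 := by
  induction l generalizing k with
  | zero => simpa using h
  | succ l ih =>
    have hq : 0 < q := (hc 0).trans_le (hcq 0)
    rw [show k + (l + 1) = k + 1 + l by omega]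
    refine ih (k + 1) (fun n h₁ h₂ => hS n (by omega) (by omega)) ?_
    rw [hS k le_rfl (by omega)]
    rw [Finset.sum_range_succ', pow_zero] at h
    simp_rw [pow_succ] at h
    rw [← Finset.sum_mul] at h
    have hT : 0 ≤ ε * ∑ i ∈ Finset.range l, (1 / q) ^ i := by positivity
    calc c k * (S k - ε)
        < c k * (ε * (∑ i ∈ Finset.range l, (1 / q) ^ i) * (1 / q)) :=
          mul_lt_mul_of_pos_left (by linarith) (hc k)
      _ = c k / q * (ε * ∑ i ∈ Finset.range l, (1 / q) ^ i) := by ring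
      _ ≤ ε * ∑ i ∈ Finset.range l, (1 / q) ^ i :=
          mul_le_of_le_one_left hT ((div_le_one hq).2 (hcq k))

/-- `l` consecutive negative noise steps of size `ε` after stage
`k` force collapse at stage `k + l`, provided `ε·Σ_{i<l} ξ̄^{-i} > Π_k + N_k`. -/
theorem stmt_10 {J : Type*} [Fintype J] [Nonempty J]
    (ξ : J → ℝ) (hξ : ∀ a, 0 < ξ a ∧ ξ a < 1)
    (j : ℕ → J) (δ : ℕ → ℝ) (N P : ℕ → ℝ)
    (hN0 : N 0 = 0) (hN : ∀ n, N (n + 1) = ξ (j (n + 1)) * (N n + δ (n + 1)))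
    (hP : ∀ n, P n = ∏ i ∈ Finset.Icc 1 n, ξ (j i))
    (ξbar ε : ℝ) (hξbar : ∀ a, ξ a ≤ ξbar) (hξbar1 : ξbar < 1) (hε : 0 < ε)
    (k l : ℕ) (hl : 1 ≤ l)
    (hδ : ∀ i, k + 1 ≤ i → i ≤ k + l → δ i = -ε)
    (hsum : ε * ∑ i ∈ Finset.range l, (1 / ξbar) ^ i > P k + N k) :
    N (k + l) < -P (k + l) := by
  have hneg := neg_of_lt_geom_sum (S := fun n => P n + N n) (c := fun n => ξ (j (n + 1)))
    (fun n => (hξ _).1) (fun n => hξbar _) hε.le l k (fun n h₁ h₂ => by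
      have hPn : P (n + 1) = P n * ξ (j (n + 1)) := by
        rw [hP, hP, Finset.prod_Icc_succ_top (by omega)]
      simp only [hN, hPn, hδ (n + 1) (by omega) (by omega)]
      ring) hsum
  linarith
end

section
/- Suppose ξ_j ≤ ξ̄ < 1 for all j ∈ J, 0 < ε < 1, and ξ̄ + ε/(1 − ξ̄) < 1. Set n₀ = ⌊ log(1 + (1/ξ̄ − 1)/ε) / log(1/ξ̄) ⌋ + 1. Suppose δ_i ∈ {−ε, ε} for all i, and suppose there exists k ≥ 0 such that δ_{k+1} = δ_{k+2} = ⋯ = δ_{k+n₀} = −ε. Then there exists n with 1 ≤ n ≤ k + n₀ such that N_n ≤ −Π_n, i.e. the iteration collapses by stage k + n₀. -/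
open Finset Real

/-- A number `0 < x < 1` raised to a power exceeding `log A / log (1 / x)` is at most
`1 / A`. -/
lemma mul_pow_floor_log_div_log_le_one {x A : ℝ} (hx0 : 0 < x) (hx1 : x < 1) (hA : 0 < A) :
    A * x ^ (⌊Real.log A / Real.log (1 / x)⌋₊ + 1) ≤ 1 := by
  set m := ⌊Real.log A / Real.log (1 / x)⌋₊ + 1 with hm
  have hlog : 0 < Real.log (1 / x) := Real.log_pos (by rw [lt_div_iff₀ hx0]; linarith)
  have hlt : Real.log A / Real.log (1 / x) < m := by
    rw [hm]
    exact_mod_cast Nat.lt_floor_add_one (Real.log A / Real.log (1 / x))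
  rw [div_lt_iff₀ hlog, ← Real.log_pow, Real.log_lt_log_iff hA (by positivity), one_div,
    inv_pow] at hlt
  rw [← le_div_iff₀ (by positivity), one_div]
  exact hlt.le

/-- for `±ε` noise with `ξ̄ + ε/(1-ξ̄) < 1`, a run of `n₀`
consecutive negative steps after some stage `k` forces collapse by stage
`k + n₀`, where `n₀ = ⌊log(1 + (1/ξ̄-1)/ε)/log(1/ξ̄)⌋ + 1`. -/
theorem stmt_12 {J : Type*} [Fintype J] [Nonempty J]
    (ξ : J → ℝ) (hξ : ∀ a, 0 < ξ a ∧ ξ a < 1)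
    (j : ℕ → J) (δ : ℕ → ℝ) (N P : ℕ → ℝ)
    (hN0 : N 0 = 0) (hN : ∀ n, N (n + 1) = ξ (j (n + 1)) * (N n + δ (n + 1)))
    (hP : ∀ n, P n = ∏ i ∈ Finset.Icc 1 n, ξ (j i))
    (ξbar ε : ℝ) (hξbar : ∀ a, ξ a ≤ ξbar) (hξbar1 : ξbar < 1)
    (hε0 : 0 < ε) (hε1 : ε < 1) (hcond : ξbar + ε / (1 - ξbar) < 1)
    (n₀ : ℕ)
    (hn₀ : n₀ = ⌊Real.log (1 + (1 / ξbar - 1) / ε) / Real.log (1 / ξbar)⌋₊ + 1)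
    (hδ : ∀ i, 1 ≤ i → δ i = -ε ∨ δ i = ε)
    (k : ℕ) (hk : ∀ i, k + 1 ≤ i → i ≤ k + n₀ → δ i = -ε) :
    ∃ n, 1 ≤ n ∧ n ≤ k + n₀ ∧ N n ≤ -P n := by
  obtain ⟨hx0⟩ : Nonempty (0 < ξbar) := (inferInstance : Nonempty J).map fun a =>
    (hξ a).1.trans_le (hξbar a)
  have hy : 0 < 1 - ξbar := by linarith
  have hεlt : ε < (1 - ξbar) * (1 - ξbar) := by
    rw [← div_lt_iff₀ hy]; linarith
  by_contra! hcon
  have hPsucc (n : ℕ) : P (n + 1) = ξ (j (n + 1)) * P n := by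
    rw [hP, hP, Finset.prod_Icc_succ_top (by omega), mul_comm]
  have hstep (n : ℕ) (hn : n + 1 ≤ k + n₀) :
      N (n + 1) + P (n + 1) ≤ ξbar * (N n + P n + δ (n + 1)) := by
    have hpos := hcon (n + 1) (by omega) hn
    have heq : N (n + 1) + P (n + 1) = ξ (j (n + 1)) * (N n + P n + δ (n + 1)) := by
      rw [hN, hPsucc]; ring
    have hfactor : 0 < N n + P n + δ (n + 1) :=
      pos_of_mul_pos_right (by rw [← heq]; linarith) (hξ (j (n + 1))).1.le
    rw [heq]
    exact mul_le_mul_of_nonneg_right (hξbar _) hfactor.le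
  have hle_one (n : ℕ) (hn : n ≤ k + n₀) : N n + P n ≤ 1 := by
    induction n with
    | zero => simp [hN0, hP]
    | succ n ih =>
      have hδle : δ (n + 1) ≤ ε := by
        rcases hδ (n + 1) (by omega) with h | h <;> linarith
      calc N (n + 1) + P (n + 1) ≤ ξbar * (N n + P n + δ (n + 1)) := hstep n hn
        _ ≤ ξbar * (1 + ε) := by
          gcongr
          exact ih (by omega)
        _ ≤ 1 := by nlinarith [mul_pos hx0 hy, mul_pos hy hy]
  set c := ε * ξbar / (1 - ξbar) with hc
  have hc0 : 0 < c := by positivity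
  have hcfix : c * (1 - ξbar) = ε * ξbar := div_mul_cancel₀ _ hy.ne'
  have hgeom (m : ℕ) (hm : m ≤ n₀) : N (k + m) + P (k + m) + c ≤ ξbar ^ m * (1 + c) := by
    induction m with
    | zero => simpa using hle_one k (by omega)
    | succ m ih =>
      have h := hstep (k + m) (by omega)
      rw [hk (k + m + 1) (by omega) (by omega)] at h
      have hmul := mul_le_mul_of_nonneg_left (ih (by omega)) hx0.le
      rw [← add_assoc k m 1, pow_succ]
      linarith
  have hA : 1 + (1 / ξbar - 1) / ε = (1 + c) / c := by
    rw [hc]; field_simp; ring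
  have hfinal : ξbar ^ n₀ * (1 + c) ≤ c := by
    have h := mul_pow_floor_log_div_log_le_one hx0 hξbar1 (A := (1 + c) / c) (by positivity)
    rw [← hA, ← hn₀, hA, div_mul_eq_mul_div, div_le_one hc0] at h
    linarith
  have h1 := hgeom n₀ le_rfl
  have h2 := hcon (k + n₀) (by omega) le_rfl
  linarith
end

section
/- Suppose ξ_j ≤ ξ̄ < 1 for all j ∈ J, 0 < ε < 1, and ξ̄ + ε/(1 − ξ̄) < 1. Set n₀ = ⌊ log(1 + (1/ξ̄ − 1)/ε) / log(1/ξ̄) ⌋ + 1. Let T be the tent map, x_n = Tⁿ(x_0), and define δ_n = −ε if x_n < 1/2 and δ_n = ε if x_n ≥ 1/2. If there exists k ≥ 0 with 0 < x_k < 1/2^{n₀+1}, then there exists a stage n ≥ 1 with L_n ≤ 0; i.e. for every infinite sequence of indices j : ℕ → J, the iterative procedure generating the self-similar set is truncated at a finite order. -/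
open Finset Real

/-- The tent map `T(x) = 2x` for `x < 1/2` and `T(x) = 2(1-x)` for `x ≥ 1/2`. -/
noncomputable def tentMap (x : ℝ) : ℝ := if x < 1 / 2 then 2 * x else 2 * (1 - x)

/-- While `2 ^ i * x` stays below `1`, the tent map acts on `x` by doubling. -/
theorem tentMap_iterate_eq {x : ℝ} (hx : 0 ≤ x) :
    ∀ i : ℕ, 2 ^ i * x < 1 → tentMap^[i] x = 2 ^ i * x
  | 0, _ => by simp
  | i + 1, h => by
    have hp : 0 ≤ 2 ^ i * x := by positivity
    have h2 : 2 ^ i * x < 1 / 2 := by rw [pow_succ] at h; linarith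
    rw [Function.iterate_succ_apply', tentMap_iterate_eq hx i (by linarith), tentMap, if_pos h2]
    ring

theorem le_pow_of_log_div_lt {q A : ℝ} (hq : 1 < q) (hA : 0 < A) {n : ℕ}
    (h : Real.log A / Real.log q < n) : A ≤ q ^ n := by
  rw [div_lt_iff₀ (Real.log_pos hq), ← Real.log_pow] at h
  exact ((Real.log_lt_log_iff hA (by positivity)).1 h).le

/-- One step of a contraction with ratio at most `b`, whose image is positive. -/
theorem le_mul_of_eq_mul_of_pos {a b y z : ℝ} (ha : 0 < a) (hab : a ≤ b) (hz : 0 < z)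
    (h : z = a * y) : z ≤ b * y := by
  have hy : 0 < y := pos_of_mul_pos_right (h ▸ hz) ha.le
  rw [h]
  gcongr

/-- with tent-map driven noise `δ_n = -ε` if `xₙ < 1/2`, `δ_n = ε`
otherwise, if the orbit of `x₀` enters `(0, 1/2^(n₀+1))` then the iteration is
truncated at a finite order: some stage `n ≥ 1` has `L_n ≤ 0`. -/
theorem stmt_13 {J : Type*} [Fintype J] [Nonempty J]
    (ξ : J → ℝ) (hξ : ∀ a, 0 < ξ a ∧ ξ a < 1)
    (j : ℕ → J) (δ : ℕ → ℝ) (L : ℕ → ℝ)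
    (hL0 : L 0 = 1) (hL : ∀ n, L (n + 1) = ξ (j (n + 1)) * (L n + δ (n + 1)))
    (ξbar ε : ℝ) (hξbar : ∀ a, ξ a ≤ ξbar) (hξbar1 : ξbar < 1)
    (hε0 : 0 < ε) (hε1 : ε < 1) (hcond : ξbar + ε / (1 - ξbar) < 1)
    (n₀ : ℕ)
    (hn₀ : n₀ = ⌊Real.log (1 + (1 / ξbar - 1) / ε) / Real.log (1 / ξbar)⌋₊ + 1)
    (x₀ : ℝ)
    (hδ : ∀ n, 1 ≤ n → δ n = if tentMap^[n] x₀ < 1 / 2 then -ε else ε)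
    (hk : ∃ k : ℕ, 0 < tentMap^[k] x₀ ∧ tentMap^[k] x₀ < 1 / 2 ^ (n₀ + 1)) :
    ∃ n, 1 ≤ n ∧ L n ≤ 0 := by
  by_contra! hpos
  obtain ⟨k, hk0, hk1⟩ := hk
  have hb0 : 0 < ξbar := (hξ (j 0)).1.trans_le (hξbar _)
  have h1b : 0 < 1 - ξbar := sub_pos.2 hξbar1
  have hstep : ∀ n, L (n + 1) ≤ ξbar * (L n + δ (n + 1)) := fun n =>
    le_mul_of_eq_mul_of_pos (hξ _).1 (hξbar _) (hpos _ n.succ_pos) (hL n)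
  have hε : ε < (1 - ξbar) * (1 - ξbar) :=
    (div_lt_iff₀ h1b).1 (lt_sub_iff_add_lt'.2 hcond)
  have hle : ∀ n, L n ≤ 1 := by
    intro n
    induction n with
    | zero => exact hL0.le
    | succ n ih =>
      have hδε : δ (n + 1) ≤ ε := by
        rw [hδ _ n.succ_pos]
        split_ifs <;> linarith
      calc L (n + 1) ≤ ξbar * (L n + δ (n + 1)) := hstep n
        _ ≤ ξbar * (1 + (1 - ξbar) * (1 - ξbar)) := by gcongr; linarith
        _ ≤ 1 := by nlinarith [mul_pos hb0 h1b, sq_nonneg (1 - ξbar)]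
  have hneg : ∀ i, i + 1 ≤ n₀ → δ (k + i + 1) = -ε := by
    intro i hi
    have hlt : 2 ^ (i + 1) * tentMap^[k] x₀ < 1 / 2 := by
      calc 2 ^ (i + 1) * tentMap^[k] x₀ ≤ 2 ^ n₀ * tentMap^[k] x₀ := by
            gcongr; norm_num
        _ < 2 ^ n₀ * (1 / 2 ^ (n₀ + 1)) := by gcongr
        _ = 1 / 2 := by field_simp; ring
    rw [hδ _ (by omega), show k + i + 1 = (i + 1) + k by ring,
      Function.iterate_add_apply, tentMap_iterate_eq hk0.le _ (by linarith), if_pos hlt]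
  have hdecay : ∀ i, i ≤ n₀ →
      (1 - ξbar) * L (k + i) ≤ ξbar ^ i * (1 - ξbar) - ε * ξbar * (1 - ξbar ^ i) := by
    intro i
    induction i with
    | zero => intro _; simpa using mul_le_mul_of_nonneg_left (hle k) h1b.le
    | succ i ih =>
      intro hi
      have hs := hstep (k + i)
      rw [hneg i hi] at hs
      calc (1 - ξbar) * L (k + (i + 1)) ≤ (1 - ξbar) * (ξbar * (L (k + i) + -ε)) := by
            gcongr; exact hs
        _ = ξbar * ((1 - ξbar) * L (k + i)) - ξbar * (1 - ξbar) * ε := by ring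
        _ ≤ ξbar * (ξbar ^ i * (1 - ξbar) - ε * ξbar * (1 - ξbar ^ i))
            - ξbar * (1 - ξbar) * ε := by gcongr; exact ih (by omega)
        _ = _ := by ring
  have hq : 1 < 1 / ξbar := one_lt_one_div hb0 hξbar1
  have hA : 0 < 1 + (1 / ξbar - 1) / ε := by
    have := div_pos (sub_pos.2 hq) hε0
    linarith
  have hpow : 1 + (1 / ξbar - 1) / ε ≤ (1 / ξbar) ^ n₀ := by
    refine le_pow_of_log_div_lt hq hA ?_
    rw [hn₀]
    exact_mod_cast Nat.lt_floor_add_one _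
  have hfin : ξbar ^ n₀ * (1 - ξbar) - ε * ξbar * (1 - ξbar ^ n₀) ≤ 0 := by
    have h := mul_le_mul_of_nonneg_left hpow (by positivity : 0 ≤ ε * ξbar * ξbar ^ n₀)
    have e₁ : ε * ξbar * ξbar ^ n₀ * (1 + (1 / ξbar - 1) / ε)
        = ε * ξbar * ξbar ^ n₀ + ξbar ^ n₀ * (1 - ξbar) := by field_simp
    have e₂ : ε * ξbar * ξbar ^ n₀ * (1 / ξbar) ^ n₀ = ε * ξbar := by
      rw [one_div, inv_pow, mul_inv_cancel_right₀ (by positivity)]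
    linarith
  have hn : 0 < L (k + n₀) := hpos _ (by omega)
  linarith [hdecay n₀ le_rfl, mul_pos h1b hn]
end

section
/- Suppose ξ_j ≤ ξ̄ < 1 for all j ∈ J, 0 < ε < 1, and ξ̄ + ε/(1 − ξ̄) < 1. Let T be the tent map. Then for Lebesgue-almost every x_0 ∈ [0, 1], the following holds: setting x_n = Tⁿ(x_0) and δ_n = −ε if x_n < 1/2, δ_n = ε if x_n ≥ 1/2, and for every infinite sequence of indices j : ℕ → J, there exists n ≥ 1 with L_n ≤ 0 (the self-similar structure is truncated at a finite order of iteration). -/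
open Finset MeasureTheory Real

/-- The perturbed diameter sequence: `L 0 = 1`, `L n = ξ_{j_n} (L_{n-1} + δ_n)`. -/
noncomputable def Lseq {J : Type*} (ξ : J → ℝ) (j : ℕ → J) (δ : ℕ → ℝ) : ℕ → ℝ
  | 0 => 1
  | n + 1 => ξ (j (n + 1)) * (Lseq ξ j δ n + δ (n + 1))

lemma tentMap_mapsTo : Set.MapsTo tentMap (Set.Icc 0 1) (Set.Icc 0 1) := by
  rintro x ⟨h0, h1⟩
  unfold tentMap
  split_ifs <;> constructor <;> linarith

lemma tentMap_eq_two_mul_norm {x : ℝ} (hx : x ∈ Set.Icc (0 : ℝ) 1) :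
    tentMap x = 2 * ‖(x : UnitAddCircle)‖ := by
  obtain ⟨h0, h1⟩ := hx
  unfold tentMap
  split_ifs with h
  · rw [(AddCircle.norm_coe_eq_abs_iff 1 one_ne_zero).2, abs_of_nonneg h0]
    rw [abs_of_nonneg h0, abs_one]
    exact h.le
  · have hshift : (x : UnitAddCircle) = ((x - 1 : ℝ) : UnitAddCircle) := by
      rw [AddCircle.coe_sub, AddCircle.coe_period, sub_zero]
    have habs : |x - 1| = 1 - x := by rw [abs_of_nonpos (by linarith)]; ring
    rw [hshift, (AddCircle.norm_coe_eq_abs_iff 1 one_ne_zero).2, habs]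
    rw [habs, abs_one]
    linarith

lemma coe_tentMap (x : ℝ) :
    (tentMap x : UnitAddCircle) = 2 • (x : UnitAddCircle) ∨
      (tentMap x : UnitAddCircle) = -(2 • (x : UnitAddCircle)) := by
  unfold tentMap
  split_ifs with h
  · left
    rw [← AddCircle.coe_nsmul, nsmul_eq_mul, Nat.cast_ofNat]
  · right
    have hsub : 2 * (1 - x) = (1 + 1) - 2 • x := by rw [nsmul_eq_mul]; push_cast; ring
    rw [hsub, AddCircle.coe_sub, AddCircle.coe_add, AddCircle.coe_period, AddCircle.coe_nsmul]
    simp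

lemma norm_coe_tentMap_iterate (x : ℝ) (n : ℕ) :
    ‖(tentMap^[n] x : UnitAddCircle)‖ = ‖2 ^ n • (x : UnitAddCircle)‖ := by
  have key : (tentMap^[n] x : UnitAddCircle) = 2 ^ n • (x : UnitAddCircle) ∨
      (tentMap^[n] x : UnitAddCircle) = -(2 ^ n • (x : UnitAddCircle)) := by
    induction n with
    | zero => simp
    | succ n ih =>
      rw [Function.iterate_succ_apply', pow_succ', mul_smul]
      rcases coe_tentMap (tentMap^[n] x) with h | h <;> rcases ih with ih | ih <;>
        rw [h, ih] <;> simp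
  rcases key with h | h <;> simp [h]

lemma tentMap_iterate_succ {x : ℝ} (hx : x ∈ Set.Icc (0 : ℝ) 1) (n : ℕ) :
    tentMap^[n + 1] x = 2 * ‖2 ^ n • (x : UnitAddCircle)‖ := by
  rw [Function.iterate_succ_apply', tentMap_eq_two_mul_norm (tentMap_mapsTo.iterate n hx),
    norm_coe_tentMap_iterate]

/-- Almost every orbit of an ergodic map visits a given set of positive measure. -/
lemma Ergodic.ae_exists_iterate_mem {α : Type*} [MeasurableSpace α] {μ : Measure α}
    [IsFiniteMeasure μ] {f : α → α} (hf : Ergodic f μ) {s : Set α} (hs : MeasurableSet s)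
    (hpos : μ s ≠ 0) : ∀ᵐ x ∂μ, ∃ n, f^[n] x ∈ s := by
  set t : Set α := {x | ∀ n, f^[n] x ∉ s} with ht
  have htm : MeasurableSet t := by
    rw [ht, Set.ofPred_forall]
    exact MeasurableSet.iInter fun n => (hf.measurable.iterate n hs).compl
  have hle : t ⊆ f ⁻¹' t := fun x hx n => by
    rw [← Function.iterate_succ_apply]
    exact hx (n + 1)
  rcases hf.ae_empty_or_univ_of_ae_le_preimage htm.nullMeasurableSet
    hle.eventuallyLE with h | h
  · have h0 : μ t = 0 := ae_eq_empty.1 h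
    rw [ae_iff]
    simpa [ht] using h0
  · refine absurd (measure_mono_null (fun x hx => ?_) (ae_eq_univ.1 h)) hpos
    exact fun hxt => hxt 0 hx

lemma ae_exists_norm_two_pow_nsmul_lt {r : ℝ} (hr : 0 < r) :
    ∀ᵐ x : ℝ ∂(volume.restrict (Set.Icc (0 : ℝ) 1)),
      ∃ n : ℕ, ‖2 ^ n • (x : UnitAddCircle)‖ < r := by
  have herg : Ergodic fun y : UnitAddCircle => 2 • y := AddCircle.ergodic_nsmul one_lt_two
  have hvisit := herg.ae_exists_iterate_mem (s := Metric.ball 0 r) measurableSet_ball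
    (Metric.measure_ball_pos _ _ hr).ne'
  have hpull := (UnitAddCircle.measurePreserving_mk 0).quasiMeasurePreserving.ae hvisit
  rw [zero_add, restrict_Ioc_eq_restrict_Icc] at hpull
  filter_upwards [hpull] with x ⟨n, hn⟩
  refine ⟨n, ?_⟩
  rwa [smul_iterate_apply, mem_ball_zero_iff] at hn

lemma tentMap_iterate_lt_half {x : ℝ} (hx : x ∈ Set.Icc (0 : ℝ) 1) {n N i : ℕ}
    (hn : ‖2 ^ n • (x : UnitAddCircle)‖ < 1 / 2 ^ (N + 1)) (hi : i < N) :
    tentMap^[n + i + 1] x < 1 / 2 := by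
  rw [tentMap_iterate_succ hx, add_comm n i, pow_add, mul_smul]
  have hle : ‖2 ^ i • 2 ^ n • (x : UnitAddCircle)‖ ≤
      2 ^ i * ‖2 ^ n • (x : UnitAddCircle)‖ := by
    simpa using norm_nsmul_le (n := 2 ^ i) (a := 2 ^ n • (x : UnitAddCircle))
  have hpow : (2 : ℝ) ^ (i + 2) ≤ 2 ^ (N + 1) :=
    pow_le_pow_right₀ one_le_two (by omega)
  rw [lt_div_iff₀ (by positivity)] at hn
  have hmul := mul_le_mul_of_nonneg_left hpow (norm_nonneg (2 ^ n • (x : UnitAddCircle)))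
  rw [pow_add] at hmul
  linarith

lemma Lseq_le_of_pos {J : Type*} {ξ : J → ℝ} {j : ℕ → J} {δ : ℕ → ℝ} {q : ℝ}
    (hξ : ∀ a, 0 < ξ a) (hq : ∀ a, ξ a ≤ q) (hq1 : q < 1) (hδ : ∀ n, δ n ≤ 1)
    (hpos : ∀ n, 0 < Lseq ξ j δ n) (n : ℕ) : Lseq ξ j δ n ≤ 1 + 1 / (1 - q) := by
  have h1q : 0 < 1 - q := sub_pos.2 hq1
  induction n with
  | zero =>
    rw [Lseq]
    have := one_div_pos.2 h1q
    linarith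
  | succ n ih =>
    have hp := hpos n
    have hq0 : 0 ≤ q := (hξ (j 0)).le.trans (hq _)
    calc Lseq ξ j δ (n + 1) = ξ (j (n + 1)) * (Lseq ξ j δ n + δ (n + 1)) := rfl
      _ ≤ ξ (j (n + 1)) * (Lseq ξ j δ n + 1) :=
        mul_le_mul_of_nonneg_left (by linarith [hδ (n + 1)]) (hξ _).le
      _ ≤ q * (Lseq ξ j δ n + 1) := mul_le_mul_of_nonneg_right (hq _) (by linarith)
      _ ≤ q * (1 + 1 / (1 - q) + 1) := mul_le_mul_of_nonneg_left (by linarith) hq0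
      _ ≤ 1 + 1 / (1 - q) := by
        have : (1 / (1 - q)) * (1 - q) = 1 := one_div_mul_cancel h1q.ne'
        linarith

lemma Lseq_add_le_sub_mul {J : Type*} {ξ : J → ℝ} {j : ℕ → J} {δ : ℕ → ℝ} {ε : ℝ}
    (hξ : ∀ a, 0 < ξ a ∧ ξ a < 1) (hpos : ∀ n, 0 < n → 0 < Lseq ξ j δ n) {n N : ℕ}
    (hδ : ∀ i < N, δ (n + i + 1) = -ε) :
    ∀ i ≤ N, Lseq ξ j δ (n + i) ≤ Lseq ξ j δ n - i * ε := by
  intro i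
  induction i with
  | zero => simp
  | succ i ih =>
    intro hi
    have hstep : Lseq ξ j δ (n + i + 1) =
        ξ (j (n + i + 1)) * (Lseq ξ j δ (n + i) - ε) := by
      rw [Lseq, hδ i hi, sub_eq_add_neg]
    have hp := hpos (n + i + 1) (Nat.succ_pos _)
    obtain ⟨h0, h1⟩ := hξ (j (n + i + 1))
    rw [hstep] at hp
    have hlt := mul_le_of_le_one_left (pos_of_mul_pos_right hp h0.le).le h1.le
    rw [← add_assoc, hstep]
    push_cast
    linarith [ih (by omega)]

/-- for Lebesgue-almost every `x₀ ∈ [0,1]`, the tent-map driven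
noise truncates the self-similar structure at a finite order, for every
infinite sequence of indices `j`. -/
theorem stmt_14 {J : Type*} [Fintype J] [Nonempty J]
    (ξ : J → ℝ) (hξ : ∀ a, 0 < ξ a ∧ ξ a < 1)
    (ξbar ε : ℝ) (hξbar : ∀ a, ξ a ≤ ξbar) (hξbar1 : ξbar < 1)
    (hε0 : 0 < ε) (hε1 : ε < 1) (hcond : ξbar + ε / (1 - ξbar) < 1) :
    ∀ᵐ x₀ ∂(volume.restrict (Set.Icc (0 : ℝ) 1)),
      ∀ j : ℕ → J, ∃ n, 1 ≤ n ∧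
        Lseq ξ j (fun m => if tentMap^[m] x₀ < 1 / 2 then -ε else ε) n ≤ 0 := by
  obtain ⟨N, hN⟩ := exists_nat_gt ((1 + 1 / (1 - ξbar)) / ε)
  rw [div_lt_iff₀ hε0] at hN
  filter_upwards [ae_exists_norm_two_pow_nsmul_lt (r := 1 / 2 ^ (N + 1)) (by positivity),
    ae_restrict_mem measurableSet_Icc] with x ⟨n, hn⟩ hx j
  by_contra! hpos
  have hpos' : ∀ n, 0 < Lseq ξ j (fun m => if tentMap^[m] x < 1 / 2 then -ε else ε) n
    | 0 => by rw [Lseq]; exact one_pos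
    | n + 1 => hpos (n + 1) (by omega)
  have hdrop := Lseq_add_le_sub_mul (N := N) (n := n) (ε := ε) hξ (fun n _ => hpos' n)
    (fun i hi => if_pos (tentMap_iterate_lt_half hx hn hi)) N le_rfl
  have hbound := Lseq_le_of_pos (fun a => (hξ a).1) hξbar hξbar1
    (fun m => by split_ifs <;> linarith) hpos' n
  linarith [hpos' (n + N)]
end
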